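/- arXiv:cs/0305016 — 3 statements merged into one kernel-verified Lean document; each statement's English description precedes it below -/
import Mathlib

section
/- Let n ≥ 3, let r be a real number with 0 < r ≤ √2, let Q = [0, 2n] × [0, 2r] ⊆ ℝ², and let W = {(2i−1, r) : i = 1, …, n} be the 1×n grid placement. Then every point p ∈ Q satisfies μ({q ∈ Q : dist(q, p) < infDist(q, W)}) ≤ 2r, and if the y-coordinate of p is different from r then μ({q ∈ Q : dist(q, p) < infDist(q, W)}) < 2r. (For r ≤ √2, no single black point can steal more than μ(Q)/(2n) from the 1×n grid, and a point off the grid line steals strictly less.) -/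
open MeasureTheory Metric Set
open scoped ENNReal

/-- The point `(x, y)` in the Euclidean plane. -/
noncomputable def pt (x y : ℝ) : EuclideanSpace ℝ (Fin 2) :=
  (WithLp.equiv 2 (Fin 2 → ℝ)).symm ![x, y]

/-- The rectangular board `[0, 2n] × [0, 2r]`. -/
def bigBoard (n : ℕ) (r : ℝ) : Set (EuclideanSpace ℝ (Fin 2)) :=
  {q | q 0 ∈ Set.Icc (0:ℝ) (2 * n) ∧ q 1 ∈ Set.Icc (0:ℝ) (2 * r)}

lemma s13_piece (h : ℝ → ℝ≥0∞) (b k m cu cv : ℝ) (hb : 0 < b) (huv : cu ≤ cv)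
    (h0 : 0 ≤ k + m * cu) (h1 : 0 ≤ k + m * cv)
    (hh : ∀ y, cu < b * y - b^2/2 → b * y - b^2/2 ≤ cv →
      h y ≤ ENNReal.ofReal (k + m * (b * y - b^2/2))) :
    ∫⁻ y in Ioc (cu / b + b/2) (cv / b + b/2), h y ≤
      ENNReal.ofReal ((k * (cv - cu) + m * (cv^2 - cu^2)/2)/b) := by
  have hle : cu / b + b/2 ≤ cv / b + b/2 := by gcongr
  have key : ∀ y ∈ Ioc (cu / b + b/2) (cv / b + b/2),
      cu < b * y - b^2/2 ∧ b * y - b^2/2 ≤ cv := by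
    rintro y ⟨hy1, hy2⟩
    have e1 : b * (cu / b + b/2) = cu + b^2/2 := by field_simp
    have e2 : b * (cv / b + b/2) = cv + b^2/2 := by field_simp
    have := mul_lt_mul_of_pos_left hy1 hb
    have := mul_le_mul_of_nonneg_left hy2 hb.le
    constructor <;> linarith
  calc ∫⁻ y in Ioc (cu / b + b/2) (cv / b + b/2), h y
      ≤ ∫⁻ y in Ioc (cu / b + b/2) (cv / b + b/2),
          ENNReal.ofReal (k + m * (b * y - b^2/2)) :=
        setLIntegral_mono' measurableSet_Ioc fun y hy => hh y (key y hy).1 (key y hy).2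
    _ = ENNReal.ofReal (∫ y in Ioc (cu / b + b/2) (cv / b + b/2),
          (k + m * (b * y - b^2/2))) := by
        rw [ofReal_integral_eq_lintegral_ofReal]
        · exact (Continuous.integrableOn_Ioc (by fun_prop))
        · refine (ae_restrict_iff' measurableSet_Ioc).2 (Filter.Eventually.of_forall ?_)
          intro y hy
          obtain ⟨k1, k2⟩ := key y hy
          show 0 ≤ _
          rcases le_total 0 m with hm | hm
          · have := mul_le_mul_of_nonneg_left k1.le hm
            linarith
          · have := mul_le_mul_of_nonpos_left k2 hm
            linarith
    _ = _ := by
        congr 1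
        rw [← intervalIntegral.integral_of_le hle]
        have hd : ∀ y ∈ uIcc (cu / b + b/2) (cv / b + b/2),
            HasDerivAt (fun y : ℝ => k * y + m * (b * y^2/2 - b^2/2 * y))
              (k + m * (b * y - b^2/2)) y := by
          intro y _
          have a1 := (hasDerivAt_id y).const_mul k
          have a2 := ((hasDerivAt_pow 2 y).const_mul b).div_const 2
          have a3 := (hasDerivAt_id y).const_mul (b^2/2)
          have a4 := a1.add ((a2.sub a3).const_mul m)
          refine HasDerivAt.congr_deriv (f' := k * 1 + m * (b * ((2 : ℕ) * y ^ (2 - 1)) / 2 - b^2/2 * 1))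
            a4 ?_
          push_cast
          ring
        rw [intervalIntegral.integral_eq_sub_of_hasDerivAt hd
          (Continuous.intervalIntegrable (by fun_prop) _ _)]
        field_simp
        ring

set_option maxHeartbeats 2000000 in
lemma s13_main (h : ℝ → ℝ≥0∞) (b r t : ℝ) (hb : 0 < b) (hbr : b ≤ r) (hr : r^2 ≤ 2)
    (ht0 : 0 ≤ t) (ht1 : t ≤ 1) (h0 : ∀ y, y ∉ Icc (-r) r → h y = 0)
    (h1 : 0 < t → ∀ y, h y ≤ ENNReal.ofReal (1 + 2 / (t * (2 - t)) * (b * y - b^2/2)))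
    (h2 : ∀ y, h y ≤ ENNReal.ofReal (2 + 4 / (4 - t^2) * (b * y - b^2/2)))
    (h3 : t = 0 → ∀ y, b * y - b^2/2 ≤ 0 → h y = 0) :
    ∫⁻ y, h y < ENNReal.ofReal (2 * r) := by
  have hrp : 0 < r := by linarith
  obtain ⟨C, hC⟩ : ∃ C, C = b * r - b^2/2 := ⟨_, rfl⟩
  obtain ⟨D, hD⟩ : ∃ D, D = b * r + b^2/2 := ⟨_, rfl⟩
  have eC : C / b + b/2 = r := by rw [hC]; field_simp; ring
  have eD : -D / b + b/2 = -r := by rw [hD]; field_simp; ring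
  have hbb : 0 < b^2 := by positivity
  have hCpos : 0 < C := by nlinarith
  have hDC : D = C + b^2 := by rw [hC, hD]; ring
  have hC1 : C ≤ 1 := by nlinarith [sq_nonneg (r - b)]
  have hCb : C^2 < 2 * b^2 := by
    have : (r - b/2)^2 < 2 := by nlinarith
    have e : C^2 = b^2 * (r - b/2)^2 := by rw [hC]; ring
    rw [e]; nlinarith
  have fin : ∀ X : ℝ, X < C + D → ENNReal.ofReal (X / b) < ENNReal.ofReal (2 * r) := by
    intro X hX
    rw [ENNReal.ofReal_lt_ofReal_iff (by linarith), div_lt_iff₀ hb]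
    nlinarith
  have hnull : volume ({-r} : Set ℝ) = 0 := by simp
  have hI : ∫⁻ y, h y = ∫⁻ y in Ioc (-r) r, h y := by
    rw [setLIntegral_congr Ioc_ae_eq_Icc, ← lintegral_indicator measurableSet_Icc]
    congr 1
    ext y
    by_cases hy : y ∈ Icc (-r) r
    · simp only [Set.indicator_of_mem hy]
    · simp only [Set.indicator_of_notMem hy, h0 y hy]
  have split : ∀ u v w : ℝ, u ≤ v → v ≤ w → ∫⁻ y in Ioc u w, h y ≤
      (∫⁻ y in Ioc u v, h y) + ∫⁻ y in Ioc v w, h y := by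
    intro u v w huv hvw
    rw [← Ioc_union_Ioc_eq_Ioc huv hvw]
    exact lintegral_union_le _ _ _
  have h4 : (0:ℝ) < 4 - t^2 := by nlinarith
  obtain ⟨M, hM⟩ : ∃ M, M = 4 / (4 - t^2) := ⟨_, rfl⟩
  have hMe : M * (4 - t^2) = 4 := by rw [hM]; field_simp
  have hMpos : 0 < M := by rw [hM]; positivity
  rw [← hM] at h2
  have c3 : M * C^2 / 2 - t^2/2 < b^2 := by
    have : M * C^2 = C^2 + t^2 * (C^2 / (4 - t^2)) := by
      rw [hM]; field_simp; ring
    have h5 : C^2 / (4 - t^2) ≤ 1 := by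
      rw [div_le_one h4]; nlinarith
    nlinarith [sq_nonneg t]
  rw [hI]
  have dmono : ∀ x y : ℝ, x ≤ y → x / b + b / 2 ≤ y / b + b / 2 := by
    intro x y hxy; gcongr
  rcases ht0.eq_or_lt with ht | ht
  · have h3 := h3 ht.symm
    have p1 := s13_piece h b 0 0 (-D) 0 hb (by nlinarith) (by simp) (by simp)
      (fun y _ hy => by rw [h3 y hy]; simp)
    have p2 := s13_piece h b 2 M 0 C hb hCpos.le (by norm_num) (by positivity)
      (fun y _ _ => h2 y)
    have s := split (-D / b + b/2) (0 / b + b/2) (C / b + b/2) (dmono _ _ (by nlinarith))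
      (dmono _ _ hCpos.le)
    rw [eC, eD] at s
    rw [eD] at p1
    rw [eC] at p2
    refine lt_of_le_of_lt (s.trans (add_le_add p1 p2)) ?_
    have z : ENNReal.ofReal ((0 * (0 - -D) + 0 * (0 ^ 2 - (-D) ^ 2) / 2) / b) = 0 := by simp
    rw [z, zero_add]
    apply fin
    subst ht
    nlinarith
  · have h1 := h1 ht
    obtain ⟨K, hK⟩ : ∃ K, K = 2 / (t * (2 - t)) := ⟨_, rfl⟩
    have h2t : 0 < 2 - t := by linarith
    have hKpos : 0 < K := by rw [hK]; positivity
    have hKe : K * (t * (2 - t) / 2) = 1 := by rw [hK]; field_simp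
    rw [← hK] at h1
    obtain ⟨κ, hκ⟩ : ∃ κ, κ = t * (2 - t) / 2 := ⟨_, rfl⟩
    rw [← hκ] at hKe
    have hκpos : 0 < κ := by rw [hκ]; positivity
    have hκ2 : K * κ^2 = κ := by rw [pow_two, ← mul_assoc, hKe, one_mul]
    rcases le_or_gt D κ with c | c
    · have hDK : K * D ≤ 1 := by
        rw [← hKe]; gcongr
      have p := s13_piece h b 1 K (-D) C hb (by nlinarith) (by linarith) (by positivity)
        (fun y _ _ => h1 y)
      rw [eC, eD] at p
      refine lt_of_le_of_lt p ?_
      apply fin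
      have : C^2 < D^2 := by
        apply pow_lt_pow_left₀ _ hCpos.le (by norm_num)
        linarith only [hDC, hbb]
      have := mul_lt_mul_of_pos_left this hKpos
      linarith only [this]
    · have p1 := s13_piece h b 0 0 (-D) (-κ) hb (by linarith) (by simp) (by simp)
        (fun y _ hy => by
          refine (h1 y).trans ?_
          apply ENNReal.ofReal_le_ofReal
          have := mul_le_mul_of_nonneg_left hy hKpos.le
          linarith)
      rw [eD] at p1
      have z : ENNReal.ofReal ((0 * (-κ - -D) + 0 * ((-κ) ^ 2 - (-D) ^ 2) / 2) / b) = 0 := by simp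
      rw [z] at p1
      have s := split (-D / b + b/2) (-κ / b + b/2) (C / b + b/2) (dmono _ _ (by linarith))
        (dmono _ _ (by linarith))
      rw [eC, eD] at s
      obtain ⟨c0, hc0⟩ : ∃ c0, c0 = t * (t + 2) / 2 := ⟨_, rfl⟩
      have hc0pos : 0 < c0 := by rw [hc0]; positivity
      rcases le_or_gt C c0 with d | d
      · have p2 := s13_piece h b 1 K (-κ) C hb (by linarith) (by linarith) (by positivity)
          (fun y _ _ => h1 y)
        rw [eC] at p2
        refine lt_of_le_of_lt (s.trans (add_le_add p1 p2)) ?_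
        rw [zero_add]
        apply fin
        have g : (K * C - 1)^2 < 2 * K * b^2 := by
          rcases le_or_gt (K * C) 1 with e | e
          · have : 1 - K * C < K * b^2 := by
              have := mul_lt_mul_of_pos_left c hKpos
              rw [hKe, hDC] at this
              linarith
            have h7 : 0 < K * C := by positivity
            have h8 : (1 - K * C) * (K * C) ≥ 0 := mul_nonneg (by linarith) h7.le
            have h9 : 0 < K * b^2 := by positivity
            linarith only [this, h8, h9, show (K * C - 1)^2 = (1 - K * C) - (1 - K * C) * (K * C) by ring]
          · have g1 : (K * C - 1)^2 < K * C^2 := by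
              have q1 : K * C - 1 ≤ 2 * t / (2 + t) * (K * C) := by
                have : K * C * (2 - t) ≤ 2 + t := by
                  have := mul_le_mul_of_nonneg_left d hKpos.le
                  have e2 : K * c0 * (2 - t) = 2 + t := by
                    rw [hK, hc0]; field_simp; ring
                  have := mul_le_mul_of_nonneg_right this h2t.le
                  linarith only [this, e2]
                rw [div_mul_eq_mul_div, le_div_iff₀ (by linarith)]
                linarith
              have q2 : (2 * t / (2 + t))^2 * K < 1 := by
                rw [hK, div_pow, div_mul_div_comm, div_lt_one (by positivity)]
                have : 8 * t < (2 - t) * (2 + t)^2 := by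
                  nlinarith only [mul_nonneg ht0 (sub_nonneg.2 ht1), ht0, ht1,
                    mul_nonneg (sq_nonneg t) (sub_nonneg.2 ht1)]
                have := mul_lt_mul_of_pos_left this ht
                linarith only [this]
              calc (K * C - 1)^2 ≤ (2 * t / (2 + t) * (K * C))^2 := by
                    apply pow_le_pow_left₀ (by linarith) q1
                _ = ((2 * t / (2 + t))^2 * K) * (K * C^2) := by ring
                _ < 1 * (K * C^2) := by gcongr
                _ = _ := by ring
            have := mul_lt_mul_of_pos_left hCb hKpos
            linarith only [this, g1]
        have : K * (1 * (C - -κ) + K * (C ^ 2 - (-κ) ^ 2) / 2) < K * (C + D) := by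
          rw [hDC]
          have e3 : K * (1 * (C - -κ) + K * (C ^ 2 - (-κ) ^ 2) / 2)
            = K * C + K * κ + ((K*C)^2 - (K * κ)^2)/2 := by ring
          rw [e3, hKe]
          linarith only [g]
        exact lt_of_mul_lt_mul_left this hKpos.le
      · have p2 := s13_piece h b 1 K (-κ) c0 hb (by linarith) (by linarith) (by positivity)
          (fun y _ _ => h1 y)
        have p3 := s13_piece h b 2 M c0 C hb (by linarith) (by positivity) (by positivity)
          (fun y _ _ => h2 y)
        rw [eC] at p3
        have s2 := split (-κ / b + b/2) (c0 / b + b/2) (C / b + b/2) (dmono _ _ (by linarith))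
          (dmono _ _ (by linarith))
        rw [eC] at s2
        refine lt_of_le_of_lt (s.trans (add_le_add p1 (s2.trans (add_le_add p2 p3)))) ?_
        have hKM : K * c0 = 1 + M * c0 := by
          rw [hK, hM, hc0]
          have : 4 - t^2 = (2 - t) * (2 + t) := by ring
          rw [this]
          field_simp
          ring
        rw [zero_add, ← ENNReal.ofReal_add]
        · rw [← add_div]
          apply fin
          have e4 : K * c0^2 = c0 + M * c0^2 := by
            rw [pow_two, ← mul_assoc, hKM]; ring
          have e5 : κ - c0 = - t^2 := by rw [hκ, hc0]; ring
          linarith only [e4, e5, c3, hDC, hκ2]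
        · apply div_nonneg _ hb.le
          linarith only [mul_pos hKpos (pow_pos hc0pos 2), hκ2, hκpos, hc0pos]
        · apply div_nonneg _ hb.le
          have : c0^2 ≤ C^2 := by gcongr
          have := mul_le_mul_of_nonneg_left this hMpos.le
          linarith only [this, d]

lemma s13_slice (τ c : ℝ) (X : Set ℝ) (hτ : |τ| ≤ 1)
    (hX : ∀ x ∈ X, 2 * (-2 - τ) * x < 4 - τ^2 + 2 * c ∧ 2 * (0 - τ) * x < 0 - τ^2 + 2 * c ∧
      2 * (2 - τ) * x < 4 - τ^2 + 2 * c) :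
    (0 < |τ| → volume X ≤ ENNReal.ofReal (1 + 2 / (|τ| * (2 - |τ|)) * c)) ∧
    volume X ≤ ENNReal.ofReal (2 + 4 / (4 - |τ|^2) * c) ∧
    (|τ| = 0 → c ≤ 0 → volume X = 0) := by
  have aux : ∀ L R E : ℝ, (∀ x ∈ X, L < x) → (∀ x ∈ X, x < R) → R - L = E →
      volume X ≤ ENNReal.ofReal E := by
    intro L R E hL hR hE
    rw [← hE, ← Real.volume_Ioo]
    exact measure_mono fun x hx => ⟨hL x hx, hR x hx⟩
  obtain ⟨l, u⟩ := abs_le.1 hτ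
  have a1 : 0 < 2 - τ := by linarith
  have a2 : 0 < 2 + τ := by linarith
  refine ⟨fun hp => ?_, ?_, fun hz hc => ?_⟩
  · rcases le_total 0 τ with h | h
    · rw [abs_of_nonneg h] at hp ⊢
      refine aux (τ / 2 - c / τ) ((2 + τ)/2 + c / (2 - τ)) _ (fun x hx => ?_) (fun x hx => ?_) ?_
      · obtain ⟨_, h1, _⟩ := hX x hx
        have : τ / 2 - c / τ = (τ^2 - 2 * c) / (2 * τ) := by field_simp
        rw [this, div_lt_iff₀ (by positivity)]
        linarith
      · obtain ⟨_, _, h1⟩ := hX x hx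
        have : (2 + τ)/2 + c / (2 - τ) = (4 - τ^2 + 2 * c) / (2 * (2 - τ)) := by field_simp; ring
        rw [this, lt_div_iff₀ (by positivity)]
        linarith
      · field_simp; ring
    · rw [abs_of_nonpos h] at hp ⊢
      have e1 : τ ≠ 0 := by linarith
      have e2 : 2 - -τ ≠ 0 := by linarith
      refine aux (-(2 - τ)/2 - c / (2 + τ)) (τ / 2 - c / τ) _ (fun x hx => ?_) (fun x hx => ?_) ?_
      · obtain ⟨h1, _, _⟩ := hX x hx
        have : -(2 - τ)/2 - c / (2 + τ) = (-(4 - τ^2 + 2 * c)) / (2 * (2 + τ)) := by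
          field_simp; ring
        rw [this, div_lt_iff₀ (by positivity)]
        linarith
      · obtain ⟨_, h1, _⟩ := hX x hx
        have : τ / 2 - c / τ = (0 - τ^2 + 2 * c) / (2 * (-τ)) := by field_simp; ring
        rw [this, lt_div_iff₀ (by positivity)]
        linarith
      · have e3 : 2 - -τ = 2 + τ := by ring
        rw [e3]; field_simp; ring
  · rw [sq_abs]
    have e3 : 4 - τ^2 = (2 - τ) * (2 + τ) := by ring
    refine aux (-(2 - τ)/2 - c / (2 + τ)) ((2 + τ)/2 + c / (2 - τ)) _
      (fun x hx => ?_) (fun x hx => ?_) ?_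
    · obtain ⟨h1, _, _⟩ := hX x hx
      have : -(2 - τ)/2 - c / (2 + τ) = (-(4 - τ^2 + 2 * c)) / (2 * (2 + τ)) := by
        field_simp; ring
      rw [this, div_lt_iff₀ (by positivity)]
      linarith
    · obtain ⟨_, _, h1⟩ := hX x hx
      have : (2 + τ)/2 + c / (2 - τ) = (4 - τ^2 + 2 * c) / (2 * (2 - τ)) := by field_simp; ring
      rw [this, lt_div_iff₀ (by positivity)]
      linarith
    · rw [e3]; field_simp; ring
  · have : X = ∅ := by
      ext x
      simp only [mem_empty_iff_false, iff_false]
      intro hx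
      obtain ⟨_, h1, _⟩ := hX x hx
      rw [abs_eq_zero.1 hz] at h1
      linarith
    simp [this]

/-- The set of points satisfying three of the constraints. -/
def s13_T (a y0 r w : ℝ) : Set (ℝ × ℝ) :=
  {z | z.2 ∈ Icc 0 (2 * r) ∧
    (z.1 - a)^2 + (z.2 - y0)^2 < (z.1 - (w - 2))^2 + (z.2 - r)^2 ∧
    (z.1 - a)^2 + (z.2 - y0)^2 < (z.1 - w)^2 + (z.2 - r)^2 ∧
    (z.1 - a)^2 + (z.2 - y0)^2 < (z.1 - (w + 2))^2 + (z.2 - r)^2}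

lemma s13_T_meas (a y0 r w : ℝ) : MeasurableSet (s13_T a y0 r w) := by
  unfold s13_T
  have hm : ∀ v : ℝ, MeasurableSet {z : ℝ × ℝ |
      (z.1 - a)^2 + (z.2 - y0)^2 < (z.1 - v)^2 + (z.2 - r)^2} := fun v =>
    measurableSet_lt (by fun_prop) (by fun_prop)
  exact MeasurableSet.inter (measurable_snd measurableSet_Icc) (MeasurableSet.inter (hm _)
    (MeasurableSet.inter (hm _) (hm _)))

lemma s13_T_vol (a y0 r w : ℝ) (hr0 : 0 < r) (hr : r^2 ≤ 2) (hy : y0 ∈ Icc 0 (2 * r))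
    (hw : |a - w| ≤ 1) :
    volume (s13_T a y0 r w) ≤ ENNReal.ofReal (2 * r) ∧
    (y0 ≠ r → volume (s13_T a y0 r w) < ENNReal.ofReal (2 * r)) := by
  obtain ⟨b, hb⟩ : ∃ b, b = y0 - r := ⟨_, rfl⟩
  obtain ⟨h, hh⟩ : ∃ h : ℝ → ℝ≥0∞,
    h = fun y => volume ((fun x => (x + w, y + r)) ⁻¹' s13_T a y0 r w) := ⟨_, rfl⟩
  have hvol : volume (s13_T a y0 r w) = ∫⁻ y, h y := by
    rw [Measure.volume_eq_prod, Measure.prod_apply_symm (s13_T_meas a y0 r w),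
      ← lintegral_add_right_eq_self _ r]
    congr 1
    ext y
    rw [hh]
    show _ = volume ((fun x => x + w) ⁻¹' ((fun x => (x, y + r)) ⁻¹' s13_T a y0 r w))
    rw [measure_preimage_add_right]
  have h0 : ∀ y, y ∉ Icc (-r) r → h y = 0 := by
    intro y hy
    rw [hh]
    have : ((fun x => (x + w, y + r)) ⁻¹' s13_T a y0 r w) = ∅ := by
      ext x
      simp only [mem_empty_iff_false, iff_false]
      rintro ⟨⟨k1, k2⟩, _⟩
      exact hy ⟨by simp at k1; linarith, by simp at k2; linarith⟩
    simp [this]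
  have hs : ∀ y, _ := fun y => s13_slice (a - w) (b * y - b^2/2)
    ((fun x => (x + w, y + r)) ⁻¹' s13_T a y0 r w) hw (by
      rintro x ⟨_, k1, k2, k3⟩
      simp only at k1 k2 k3
      subst hb
      refine ⟨?_, ?_, ?_⟩ <;> nlinarith)
  have hs1 : 0 < |a - w| → ∀ y, h y ≤
      ENNReal.ofReal (1 + 2 / (|a - w| * (2 - |a - w|)) * (b * y - b ^ 2 / 2)) := fun q y => by rw [hh]; exact (hs y).1 q
  have hs2 : ∀ y, h y ≤
      ENNReal.ofReal (2 + 4 / (4 - |a - w| ^ 2) * (b * y - b ^ 2 / 2)) := fun y => by rw [hh]; exact (hs y).2.1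
  have hs3 : |a - w| = 0 → ∀ y, b * y - b^2/2 ≤ 0 → h y = 0 :=
    fun q y q' => by rw [hh]; exact (hs y).2.2 q q'
  have strict : y0 ≠ r → volume (s13_T a y0 r w) < ENNReal.ofReal (2 * r) := by
    intro hne
    rw [hvol]
    have hb0 : b ≠ 0 := by rw [hb]; exact sub_ne_zero.2 hne
    rcases lt_or_gt_of_ne hb0 with hbn | hbp
    · rw [← lintegral_neg_eq_self]
      have e : ∀ y, b * (-y) - b^2/2 = (-b) * y - (-b)^2/2 := fun y => by ring
      refine s13_main (fun y => h (-y)) (-b) r |a - w| (by linarith) (by linarith [hy.1]) hr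
        (abs_nonneg _) hw ?_ ?_ ?_ ?_
      · intro y hy
        exact h0 _ fun q => hy ⟨by linarith [q.2], by linarith [q.1]⟩
      · intro q y
        rw [← e]; exact hs1 q _
      · intro y
        rw [← e]; exact hs2 _
      · intro q y
        rw [← e]; exact hs3 q _
    · exact s13_main h b r |a - w| hbp (by linarith [hy.2]) hr (abs_nonneg _) hw h0 hs1 hs2 hs3
  refine ⟨?_, strict⟩
  by_cases hne : y0 = r
  · have hb0 : b = 0 := by rw [hb, hne, sub_self]
    have hle : ∀ y, h y ≤ (Icc (-r) r).indicator 1 y := by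
      intro y
      by_cases hy : y ∈ Icc (-r) r
      · rw [Set.indicator_of_mem hy]
        rcases (abs_nonneg (a - w)).eq_or_lt with q | q
        · rw [hs3 q.symm y (by simp [hb0])]; simp
        · refine (hs1 q y).trans ?_
          simp [hb0]
      · rw [h0 y hy]; simp
    rw [hvol]
    refine (lintegral_mono hle).trans ?_
    rw [lintegral_indicator_one measurableSet_Icc, Real.volume_Icc]
    apply ENNReal.ofReal_le_ofReal; linarith
  · exact (strict hne).le

lemma s13_sub (n : ℕ) (hn : 3 ≤ n) (r : ℝ)
    (W : Set (EuclideanSpace ℝ (Fin 2)))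
    (hW : W = Set.range fun i : Fin n => pt (2 * (i : ℝ) + 1) r)
    (p q : EuclideanSpace ℝ (Fin 2)) (hq : q ∈ bigBoard n r) (hd : dist q p < infDist q W)
    (j : ℤ) : (q 0 - p 0)^2 + (q 1 - p 1)^2 < (q 0 - (2 * j + 1))^2 + (q 1 - r)^2 := by
  have key : ∀ i : Fin n,
      (q 0 - p 0)^2 + (q 1 - p 1)^2 < (q 0 - (2 * (i : ℝ) + 1))^2 + (q 1 - r)^2 := by
    intro i
    have : dist q p < dist q (pt (2 * (i : ℝ) + 1) r) :=
      lt_of_lt_of_le hd (infDist_le_dist_of_mem (by rw [hW]; exact ⟨i, rfl⟩))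
    rw [EuclideanSpace.dist_eq, EuclideanSpace.dist_eq,
      Real.sqrt_lt_sqrt_iff (by positivity)] at this
    simpa [Fin.sum_univ_two, Real.dist_eq, sq_abs, pt] using this
  obtain ⟨⟨x0, x1⟩, _⟩ := hq
  rcases lt_or_ge j 0 with h | h
  · have k := key ⟨0, by omega⟩
    simp only [Nat.cast_zero] at k
    have hj : (j : ℝ) ≤ -1 := by exact_mod_cast (by omega : j ≤ -1)
    nlinarith
  · rcases lt_or_ge j n with h' | h'
    · have k := key ⟨j.toNat, by omega⟩
      have e : ((j.toNat : ℕ) : ℝ) = (j : ℝ) := by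
        exact_mod_cast (Int.toNat_of_nonneg h)
      simp only [e] at k
      exact k
    · have k := key ⟨n - 1, by omega⟩
      have e : ((n - 1 : ℕ) : ℝ) = (n : ℝ) - 1 := by
        rw [Nat.cast_sub (by omega)]; simp
      simp only [e] at k
      have hj : (n : ℝ) ≤ j := by exact_mod_cast h'
      nlinarith

theorem stmt_13 (n : ℕ) (hn : 3 ≤ n) (r : ℝ) (hr0 : 0 < r) (hr1 : r ≤ Real.sqrt 2)
    (W : Set (EuclideanSpace ℝ (Fin 2)))
    (hW : W = Set.range fun i : Fin n => pt (2 * (i : ℝ) + 1) r)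
    (p : EuclideanSpace ℝ (Fin 2)) (hp : p ∈ bigBoard n r) :
    volume {q | q ∈ bigBoard n r ∧ dist q p < infDist q W} ≤ ENNReal.ofReal (2 * r) ∧
    (p 1 ≠ r →
      volume {q | q ∈ bigBoard n r ∧ dist q p < infDist q W} < ENNReal.ofReal (2 * r)) := by
  have hr : r^2 ≤ 2 := by
    calc r^2 ≤ (Real.sqrt 2)^2 := by gcongr
      _ = 2 := Real.sq_sqrt (by norm_num)
  obtain ⟨k, hk⟩ : ∃ k : ℤ, k = ⌊p 0 / 2⌋ := ⟨_, rfl⟩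
  have k1 : (k : ℝ) ≤ p 0 / 2 := by rw [hk]; exact Int.floor_le _
  have k2 : p 0 / 2 < k + 1 := by rw [hk]; exact Int.lt_floor_add_one _
  have hw : |p 0 - (2 * (k : ℝ) + 1)| ≤ 1 := by
    rw [abs_le]; constructor <;> linarith
  have hT := s13_T_vol (p 0) (p 1) r (2 * (k : ℝ) + 1) hr0 hr hp.2 hw
  have hle : volume {q | q ∈ bigBoard n r ∧ dist q p < infDist q W} ≤
      volume (s13_T (p 0) (p 1) r (2 * (k : ℝ) + 1)) := by
    have mp : MeasurePreserving (fun q : EuclideanSpace ℝ (Fin 2) => ((q 0, q 1) : ℝ × ℝ)) :=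
      (volume_preserving_finTwoArrow ℝ).comp (EuclideanSpace.volume_preserving_symm_measurableEquiv_toLp (Fin 2))
    rw [← mp.measure_preimage (s13_T_meas _ _ _ _).nullMeasurableSet]
    refine measure_mono ?_
    rintro q ⟨hq, hd⟩
    have hs := s13_sub n hn r W hW p q hq hd
    refine ⟨hq.2, ?_, hs k, ?_⟩
    · have := hs (k - 1)
      push_cast at this
      convert this using 3
      ring
    · have := hs (k + 1)
      push_cast at this
      convert this using 3
      ring
  exact ⟨hle.trans hT.1, fun h => lt_of_le_of_lt hle (hT.2 h)⟩
end

section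
/- Let Q ⊆ ℝ² be a compact convex set with μ(Q) > 0 and let W ⊆ Q be a finite set with |W| = n ≥ 2. If two Voronoi cells of W have different areas, i.e., there are w₁, w₂ ∈ W with μ(C(w₁)) < μ(C(w₂)), then there exists a finite set B ⊆ Q with |B| = n such that μ({q ∈ Q : infDist(q, B) < infDist(q, W)}) > μ(Q)/2. (If Wilma's Voronoi cells do not all have the same area, Barney wins: he steals almost all of the largest cell with two points and places no point in the smallest cell.) -/
open MeasureTheory Metric Set
open scoped ENNReal

/-- The Voronoi cell of `w` in the board `Q` with respect to the site set `W`: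
the points of `Q` at least as close to `w` as to every other site. -/
def cell (Q W : Set (EuclideanSpace ℝ (Fin 2))) (w : EuclideanSpace ℝ (Fin 2)) :
    Set (EuclideanSpace ℝ (Fin 2)) :=
  {q | q ∈ Q ∧ ∀ w' ∈ W, dist q w ≤ dist q w'}

/-- A set `C` is point symmetric about `c` if it is invariant under the point
reflection `q ↦ 2c − q`. -/
def PointSymmetricAbout (C : Set (EuclideanSpace ℝ (Fin 2)))
    (c : EuclideanSpace ℝ (Fin 2)) : Prop :=
  ∀ q, q ∈ C ↔ (2 : ℝ) • c - q ∈ C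

lemma bisector_null (a b : EuclideanSpace ℝ (Fin 2)) (h : a ≠ b) :
    volume {q : EuclideanSpace ℝ (Fin 2) | dist q a = dist q b} = 0 := by
  have h1 : {q : EuclideanSpace ℝ (Fin 2) | dist q a = dist q b} =
      (AffineSubspace.perpBisector a b : Set (EuclideanSpace ℝ (Fin 2))) := by
    ext q
    simp [AffineSubspace.mem_perpBisector_iff_dist_eq]
  rw [h1]
  apply Measure.addHaar_affineSubspace
  rwa [Ne, AffineSubspace.perpBisector_eq_top]

lemma hyper_null (u w : EuclideanSpace ℝ (Fin 2)) (h : u ≠ 0) :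
    volume {q : EuclideanSpace ℝ (Fin 2) | inner ℝ u (q - w) = 0} = 0 := by
  have h1 : w - u ≠ w + u := by
    intro h2
    apply h
    have h3 : (2 : ℝ) • u = 0 := by
      have : (w + u) - (w - u) = 0 := by rw [h2]; simp
      rw [two_smul]; rw [← this]; abel
    simpa using h3
  refine measure_mono_null ?_ (bisector_null _ _ h1)
  intro q hq
  simp only [mem_ofPred_eq] at hq ⊢
  rw [dist_eq_norm, dist_eq_norm, ← sq_eq_sq₀ (norm_nonneg _) (norm_nonneg _)]
  have e1 : q - (w - u) = (q - w) + u := by abel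
  have e2 : q - (w + u) = (q - w) - u := by abel
  rw [e1, e2, norm_add_sq_real (q - w) u, norm_sub_sq_real (q - w) u, real_inner_comm, hq]
  ring

/-- feasible direction -/
def Feas (Q : Set (EuclideanSpace ℝ (Fin 2))) (w u : EuclideanSpace ℝ (Fin 2)) : Prop :=
  ∃ r : ℝ, 0 < r ∧ ∀ t : ℝ, 0 < t → t < r → ∃ b ∈ Q, ∀ q ∈ Q,
    t * ‖u‖ ^ 2 < inner ℝ u (q - w) → dist q b < dist q w

lemma closer {q b w : EuclideanSpace ℝ (Fin 2)}
    (h : ‖b - w‖ ^ 2 < 2 * inner ℝ (b - w) (q - w)) : dist q b < dist q w := by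
  rw [dist_eq_norm, dist_eq_norm, ← sq_lt_sq₀ (norm_nonneg _) (norm_nonneg _)]
  have e1 : q - b = (q - w) - (b - w) := by abel
  rw [e1, norm_sub_sq_real, real_inner_comm]
  linarith

lemma feas_all {Q : Set (EuclideanSpace ℝ (Fin 2))} {w u : EuclideanSpace ℝ (Fin 2)}
    (hQc : IsCompact Q) (hQconv : Convex ℝ Q) (hw : w ∈ Q) : Feas Q w u := by
  refine ⟨1, one_pos, fun t ht _ => ?_⟩
  obtain ⟨b, hb, hbm⟩ := exists_norm_eq_iInf_of_complete_convex ⟨w, hw⟩ hQc.isComplete hQconv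
    (w + t • u)
  rw [norm_eq_iInf_iff_real_inner_le_zero hQconv hb] at hbm
  refine ⟨b, hb, fun q hq h => closer ?_⟩
  have h1 := hbm w hw
  have h2 := hbm q hq
  have e1 : w + t • u - b = t • u - (b - w) := by abel
  have e2 : w - b = - (b - w) := by abel
  have e3 : q - b = (q - w) - (b - w) := by abel
  rw [e1, e2] at h1
  rw [e1, e3] at h2
  generalize b - w = c at *
  generalize q - w = p at *
  simp only [inner_sub_left, inner_sub_right, inner_neg_right, inner_smul_left, conj_trivial,
    real_inner_self_eq_norm_sq] at h1 h2
  have h3 : inner ℝ u c ≤ ‖u‖ * ‖c‖ := real_inner_le_norm u c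
  have h4 : ‖c‖ ≤ t * ‖u‖ := by
    by_contra hcon
    push Not at hcon
    have : 0 < ‖c‖ := lt_of_le_of_lt (by positivity) hcon
    nlinarith
  have h5 : inner ℝ u c ≤ t * ‖u‖ ^ 2 := by nlinarith [norm_nonneg u]
  have h7 : t * inner ℝ u c < t * inner ℝ u p := by
    apply mul_lt_mul_of_pos_left _ ht
    linarith
  nlinarith [sq_nonneg ‖c‖]

lemma core {Q C : Set (EuclideanSpace ℝ (Fin 2))} {w u : EuclideanSpace ℝ (Fin 2)}
    (hf : Feas Q w u) (hC : MeasurableSet C) (hCQ : C ⊆ Q) (hfin : volume C ≠ ∞)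
    (ε : ℝ) (hε : 0 < ε) :
    ∃ b ∈ Q, volume.real (C ∩ {q | 0 < inner ℝ u (q - w)}) - ε <
      volume.real (C ∩ {q | 0 < inner ℝ u (q - w)} ∩ {q | dist q b < dist q w}) := by
  obtain ⟨r, hr, hf⟩ := hf
  let s : ℕ → Set (EuclideanSpace ℝ (Fin 2)) := fun k =>
    C ∩ {q | (1 / ((k : ℝ) + 1)) * ‖u‖ ^ 2 < inner ℝ u (q - w)}
  have hmono : Monotone s := by
    intro i j hij q hq
    simp only [s, mem_inter_iff, mem_ofPred_eq] at hq ⊢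
    refine ⟨hq.1, lt_of_le_of_lt ?_ hq.2⟩
    gcongr
  have hU : ⋃ k, s k = C ∩ {q | 0 < inner ℝ u (q - w)} := by
    ext q
    simp only [s, mem_iUnion, mem_inter_iff, mem_ofPred_eq]
    constructor
    · rintro ⟨k, hq, hk⟩
      exact ⟨hq, lt_of_le_of_lt (by positivity) hk⟩
    · rintro ⟨hq, hk⟩
      have : Filter.Tendsto (fun k : ℕ => (1 / ((k : ℝ) + 1)) * ‖u‖ ^ 2) Filter.atTop (nhds 0) := by
        simpa using (tendsto_one_div_add_atTop_nhds_zero_nat (𝕜 := ℝ)).mul_const (‖u‖ ^ 2)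
      obtain ⟨k, hk⟩ := (this.eventually (gt_mem_nhds hk)).exists
      exact ⟨k, hq, hk⟩
  have ht := tendsto_measure_iUnion_atTop (μ := volume) hmono
  rw [hU] at ht
  have ht2 : Filter.Tendsto (fun k => volume.real (s k)) Filter.atTop
      (nhds (volume.real (C ∩ {q | 0 < inner ℝ u (q - w)}))) :=
    (ENNReal.tendsto_toReal (measure_ne_top_of_subset inter_subset_left hfin)).comp ht
  have e1 := ht2.eventually (lt_mem_nhds (sub_lt_self _ hε))
  have e2 := (tendsto_one_div_add_atTop_nhds_zero_nat (𝕜 := ℝ)).eventually (gt_mem_nhds hr)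
  obtain ⟨k, hk1, hk2⟩ := (e1.and e2).exists
  obtain ⟨b, hb, hbq⟩ := hf _ (by positivity) hk2
  refine ⟨b, hb, hk1.trans_le ?_⟩
  apply measureReal_mono _ (measure_ne_top_of_subset
    (inter_subset_left.trans inter_subset_left) hfin)
  rintro q ⟨hq, hq2⟩
  rw [mem_ofPred_eq] at hq2
  have h0 : 0 < inner ℝ u (q - w) := lt_of_le_of_lt (by positivity) hq2
  exact ⟨⟨hq, h0⟩, hbq q (hCQ hq) hq2⟩

lemma two {Q C : Set (EuclideanSpace ℝ (Fin 2))} (hQc : IsCompact Q) (hQconv : Convex ℝ Q)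
    {w : EuclideanSpace ℝ (Fin 2)} (hw : w ∈ Q)
    (hC : MeasurableSet C) (hCQ : C ⊆ Q) (ε : ℝ) (hε : 0 < ε) :
    ∃ b ∈ Q, ∃ b' ∈ Q, volume.real C - ε <
      volume.real (C ∩ {q | dist q b < dist q w ∨ dist q b' < dist q w}) := by
  have hfin : volume C ≠ ∞ := measure_ne_top_of_subset hCQ hQc.measure_ne_top
  obtain ⟨u, hu⟩ := exists_ne (0 : EuclideanSpace ℝ (Fin 2))
  obtain ⟨b, hb, h1⟩ := core (feas_all (u := u) hQc hQconv hw) hC hCQ hfin (ε / 2) (by linarith)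
  obtain ⟨b', hb', h2⟩ := core (feas_all (u := -u) hQc hQconv hw) hC hCQ hfin (ε / 2) (by linarith)
  have hsub : ∀ s : Set (EuclideanSpace ℝ (Fin 2)), volume (C ∩ s) ≠ ∞ := fun s =>
    measure_ne_top_of_subset inter_subset_left hfin
  have hP : ∀ v : EuclideanSpace ℝ (Fin 2),
      MeasurableSet {q : EuclideanSpace ℝ (Fin 2) | 0 < inner ℝ v (q - w)} := fun v =>
    (isOpen_lt (by fun_prop) (by fun_prop)).measurableSet
  have hD : ∀ v : EuclideanSpace ℝ (Fin 2),
      MeasurableSet {q : EuclideanSpace ℝ (Fin 2) | dist q v < dist q w} := fun v =>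
    (isOpen_lt (by fun_prop) (by fun_prop)).measurableSet
  have hneg : ∀ q : EuclideanSpace ℝ (Fin 2), inner ℝ (-u) (q - w) = - inner ℝ u (q - w) :=
    fun q => inner_neg_left _ _
  have hsum : volume.real C ≤ volume.real (C ∩ {q | 0 < inner ℝ u (q - w)}) +
      volume.real (C ∩ {q | 0 < inner ℝ (-u) (q - w)}) := by
    have h3 : C ⊆ ((C ∩ {q | 0 < inner ℝ u (q - w)}) ∪ (C ∩ {q | 0 < inner ℝ (-u) (q - w)})) ∪
        (C ∩ {q | inner ℝ u (q - w) = 0}) := by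
      intro q hq
      simp only [mem_union, mem_inter_iff, mem_ofPred_eq, hneg, hq, true_and]
      rcases lt_trichotomy (inner ℝ u (q - w)) 0 with h | h | h
      · left; right; linarith
      · right; exact h
      · left; left; exact h
    have h0 : volume.real (C ∩ {q | inner ℝ u (q - w) = 0}) = 0 := by
      rw [measureReal_def, measure_mono_null inter_subset_right (hyper_null u w hu)]; rfl
    have h4 := measureReal_mono (μ := volume) h3
      (measure_union_ne_top (measure_union_ne_top (hsub _) (hsub _)) (hsub _))
    refine h4.trans ((measureReal_union_le _ _).trans ?_)
    rw [h0, add_zero]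
    exact measureReal_union_le _ _
  have hdis : Disjoint (C ∩ {q | 0 < inner ℝ u (q - w)} ∩ {q | dist q b < dist q w})
      (C ∩ {q | 0 < inner ℝ (-u) (q - w)} ∩ {q | dist q b' < dist q w}) := by
    rw [Set.disjoint_left]
    rintro q ⟨⟨_, hq1⟩, _⟩ ⟨⟨_, hq2⟩, _⟩
    simp only [mem_ofPred_eq, hneg] at hq1 hq2
    linarith
  have hun := measureReal_union (μ := volume) hdis ((hC.inter (hP _)).inter (hD _))
    (by rw [inter_assoc]; exact hsub _) (by rw [inter_assoc]; exact hsub _)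
  refine ⟨b, hb, b', hb', ?_⟩
  have hle : volume.real (C ∩ {q | 0 < inner ℝ u (q - w)} ∩ {q | dist q b < dist q w} ∪
      C ∩ {q | 0 < inner ℝ (-u) (q - w)} ∩ {q | dist q b' < dist q w}) ≤
      volume.real (C ∩ {q | dist q b < dist q w ∨ dist q b' < dist q w}) := by
    apply measureReal_mono _ (hsub _)
    rintro q (⟨⟨h, _⟩, h'⟩ | ⟨⟨h, _⟩, h'⟩)
    · exact ⟨h, Or.inl h'⟩
    · exact ⟨h, Or.inr h'⟩
  linarith

lemma one {Q C : Set (EuclideanSpace ℝ (Fin 2))} (hQc : IsCompact Q) (hQconv : Convex ℝ Q)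
    {w : EuclideanSpace ℝ (Fin 2)} (hw : w ∈ Q)
    (hC : MeasurableSet C) (hCQ : C ⊆ Q) (ε : ℝ) (hε : 0 < ε) :
    ∃ b ∈ Q, volume.real C / 2 - ε < volume.real (C ∩ {q | dist q b < dist q w}) := by
  obtain ⟨b, hb, b', hb', h⟩ := two hQc hQconv hw hC hCQ ε hε
  have h1 : volume.real (C ∩ {q | dist q b < dist q w ∨ dist q b' < dist q w}) ≤
      volume.real (C ∩ {q | dist q b < dist q w}) +
      volume.real (C ∩ {q | dist q b' < dist q w}) := by
    have : C ∩ {q | dist q b < dist q w ∨ dist q b' < dist q w} =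
      (C ∩ {q | dist q b < dist q w}) ∪ (C ∩ {q | dist q b' < dist q w}) := by
      rw [← inter_union_distrib_left]; rfl
    rw [this]
    exact measureReal_union_le _ _
  by_cases h2 : volume.real C / 2 - ε < volume.real (C ∩ {q | dist q b < dist q w})
  · exact ⟨b, hb, h2⟩
  · exact ⟨b', hb', by linarith⟩

/-- If two Voronoi cells of Wilma's placement `W` in a compact convex board `Q`
of positive area have different areas, then Barney wins: some `n`-point set
`B ⊆ Q` claims strictly more than half the area of `Q`. -/
theorem stmt_16 (Q : Set (EuclideanSpace ℝ (Fin 2))) (hQc : IsCompact Q) (hQconv : Convex ℝ Q)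
    (hQvol : 0 < volume Q) (n : ℕ) (hn : 2 ≤ n)
    (W : Set (EuclideanSpace ℝ (Fin 2))) (hWQ : W ⊆ Q) (hWfin : W.Finite)
    (hWcard : W.ncard = n)
    (w₁ w₂ : EuclideanSpace ℝ (Fin 2)) (hw₁ : w₁ ∈ W) (hw₂ : w₂ ∈ W)
    (hlt : volume (cell Q W w₁) < volume (cell Q W w₂)) :
    ∃ B : Set (EuclideanSpace ℝ (Fin 2)), B ⊆ Q ∧ B.Finite ∧ B.ncard = n ∧
      volume {q | q ∈ Q ∧ infDist q B < infDist q W} > volume Q / 2 := by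
  classical
  have hQfin : volume Q ≠ ∞ := hQc.measure_ne_top
  have hCQ : ∀ w, cell Q W w ⊆ Q := fun w q hq => hq.1
  have hCm : ∀ w, MeasurableSet (cell Q W w) := by
    intro w
    have : cell Q W w = Q ∩ ⋂ w' ∈ W, {q | dist q w ≤ dist q w'} := by
      ext q; simp [cell]
    rw [this]
    refine (hQc.isClosed.inter (isClosed_biInter fun w' _ => ?_)).measurableSet
    exact isClosed_le (by fun_prop) (by fun_prop)
  have hCfin : ∀ w, volume (cell Q W w) ≠ ∞ := fun w => measure_ne_top_of_subset (hCQ w) hQfin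
  have hlt' : volume.real (cell Q W w₁) < volume.real (cell Q W w₂) :=
    (ENNReal.toReal_lt_toReal (hCfin _) (hCfin _)).2 hlt
  have hne : w₁ ≠ w₂ := by rintro rfl; exact lt_irrefl _ hlt
  have hn0 : (0 : ℝ) < n := by exact_mod_cast (by omega : 0 < n)
  obtain ⟨ε, hε, hεn⟩ : ∃ ε : ℝ, 0 < ε ∧
      2 * (n * ε) < volume.real (cell Q W w₂) - volume.real (cell Q W w₁) := by
    refine ⟨(volume.real (cell Q W w₂) - volume.real (cell Q W w₁)) / (4 * n),
      div_pos (by linarith) (by linarith), ?_⟩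
    have : 2 * (n * ((volume.real (cell Q W w₂) - volume.real (cell Q W w₁)) / (4 * n))) =
      (volume.real (cell Q W w₂) - volume.real (cell Q W w₁)) / 2 := by
      field_simp; ring
    rw [this]; linarith
  have hone : ∀ w, ∃ b, w ∈ W → b ∈ Q ∧ volume.real (cell Q W w) / 2 - ε <
      volume.real (cell Q W w ∩ {q | dist q b < dist q w}) := by
    intro w
    by_cases hw : w ∈ W
    · obtain ⟨b, hb, h⟩ := one hQc hQconv (hWQ hw) (hCm w) (hCQ w) ε hε
      exact ⟨b, fun _ => ⟨hb, h⟩⟩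
    · exact ⟨w, fun h => absurd h hw⟩
  choose c hc using hone
  obtain ⟨b, hb, b', hb', hbb⟩ := two hQc hQconv (hWQ hw₂) (hCm w₂) (hCQ w₂) ε hε
  let F : Finset (EuclideanSpace ℝ (Fin 2)) := hWfin.toFinset
  have hFW : ∀ w, w ∈ F ↔ w ∈ W := fun w => hWfin.mem_toFinset
  have hFcard : F.card = n := by
    rw [← hWcard, ncard_eq_toFinset_card W hWfin]
  let G := (F.erase w₁).erase w₂
  have hw₂' : w₂ ∈ F.erase w₁ := Finset.mem_erase.2 ⟨hne.symm, (hFW _).2 hw₂⟩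
  have hw₁' : w₁ ∈ F := (hFW _).2 hw₁
  have hGcard : G.card + 2 = n := by
    have h1 := Finset.card_erase_add_one hw₂'
    have h2 := Finset.card_erase_add_one hw₁'
    change G.card + 1 = _ at h1
    omega
  let B0 : Finset (EuclideanSpace ℝ (Fin 2)) := G.image c ∪ {b, b'}
  have hB0card : B0.card ≤ n := by
    have h1 : B0.card ≤ _ := Finset.card_union_le (G.image c) {b, b'}
    have h2 := Finset.card_image_le (s := G) (f := c)
    have h3 := Finset.card_le_two (a := b) (b := b')
    omega
  have hGW : ∀ w ∈ G, w ∈ W := fun w hw =>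
    (hFW w).1 (Finset.mem_of_mem_erase (Finset.mem_of_mem_erase hw))
  have hB0Q : (B0 : Set (EuclideanSpace ℝ (Fin 2))) ⊆ Q := by
    intro x hx
    simp only [B0, Finset.coe_union, Finset.coe_image, mem_union, Finset.coe_insert,
      Finset.coe_singleton, mem_insert_iff, mem_singleton_iff] at hx
    rcases hx with ⟨w, hw, rfl⟩ | rfl | rfl
    · exact (hc w (hGW w hw)).1
    · exact hb
    · exact hb'
  have hQinf : Q.Infinite := fun h => hQvol.ne' (h.measure_zero volume)
  obtain ⟨B, hB0B, hBQ, hBcard⟩ : ∃ B : Finset (EuclideanSpace ℝ (Fin 2)), B0 ⊆ B ∧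
      (B : Set (EuclideanSpace ℝ (Fin 2))) ⊆ Q ∧ B.card = n := by
    obtain ⟨B, h1, h2, h3⟩ := hQinf.exists_superset_ncard_eq hB0Q B0.finite_toSet
      (k := n) (by rw [ncard_coe_finset]; exact hB0card)
    have hf : B.Finite := finite_of_ncard_pos (by omega)
    refine ⟨hf.toFinset, fun x hx => hf.mem_toFinset.2 (h1 hx), by simpa using h2, ?_⟩
    rw [← h3, ncard_eq_toFinset_card B hf]
  refine ⟨B, hBQ, B.finite_toSet, by rw [ncard_coe_finset, hBcard], ?_⟩
  set S : Set (EuclideanSpace ℝ (Fin 2)) :=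
    {q | q ∈ Q ∧ infDist q (B : Set (EuclideanSpace ℝ (Fin 2))) < infDist q W} with hS
  have hSQ : S ⊆ Q := fun q hq => hq.1
  have hSfin : volume S ≠ ∞ := measure_ne_top_of_subset hSQ hQfin
  have hSm : MeasurableSet S := by
    refine hQc.measurableSet.inter (s₂ := {q | infDist q (B : Set (EuclideanSpace ℝ (Fin 2))) <
      infDist q W}) (isOpen_lt (continuous_infDist_pt _) (continuous_infDist_pt _)).measurableSet
  have hcl : ∀ w ∈ W, ∀ q ∈ cell Q W w, ∀ x ∈ B0, dist q x < dist q w → q ∈ S := by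
    intro w hw q hq x hx h
    refine ⟨hq.1, ?_⟩
    have h1 : infDist q (B : Set (EuclideanSpace ℝ (Fin 2))) ≤ dist q x :=
      infDist_le_dist_of_mem (hB0B hx)
    have h2 : dist q w ≤ infDist q W := (le_infDist ⟨w, hw⟩).2 fun {y} hy => hq.2 y hy
    linarith
  have hSfin' : ∀ w, volume (S ∩ cell Q W w) ≠ ∞ := fun w =>
    measure_ne_top_of_subset inter_subset_left hSfin
  have hG : ∀ w ∈ G, volume.real (cell Q W w) / 2 - ε ≤ volume.real (S ∩ cell Q W w) := by
    intro w hw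
    refine (hc w (hGW w hw)).2.le.trans (measureReal_mono ?_ (hSfin' w))
    rintro q ⟨hq, h⟩
    exact ⟨hcl w (hGW w hw) q hq (c w)
      (Finset.mem_union_left _ (Finset.mem_image_of_mem c hw)) h, hq⟩
  have h2S : volume.real (cell Q W w₂) - ε ≤ volume.real (S ∩ cell Q W w₂) := by
    refine hbb.le.trans (measureReal_mono ?_ (hSfin' w₂))
    rintro q ⟨hq, h | h⟩
    · exact ⟨hcl w₂ hw₂ q hq b (by simp [B0]) h, hq⟩
    · exact ⟨hcl w₂ hw₂ q hq b' (by simp [B0]) h, hq⟩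
  have hsplit : ∀ f : EuclideanSpace ℝ (Fin 2) → ℝ, ∑ w ∈ F, f w = f w₁ + (f w₂ + ∑ w ∈ G, f w) := by
    intro f
    rw [← Finset.add_sum_erase F f hw₁', ← Finset.add_sum_erase _ f hw₂']
  have hdisj : (F : Set (EuclideanSpace ℝ (Fin 2))).Pairwise
      (Function.onFun (AEDisjoint volume) fun w => S ∩ cell Q W w) := by
    intro w hw w' hw' hww
    refine measure_mono_null ?_ (bisector_null w w' hww)
    rintro q ⟨⟨_, h1⟩, ⟨_, h2⟩⟩
    exact le_antisymm (h1.2 w' ((hFW _).1 hw')) (h2.2 w ((hFW _).1 hw))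
  have hSsum : ∑ w ∈ F, volume.real (S ∩ cell Q W w) ≤ volume.real S := by
    have h1 := measure_biUnion_finset₀ hdisj
      (fun w _ => (hSm.inter (hCm w)).nullMeasurableSet)
    have h2 : volume (⋃ w ∈ F, S ∩ cell Q W w) ≤ volume S :=
      measure_mono (iUnion₂_subset fun w _ => inter_subset_left)
    rw [h1] at h2
    have h3 := ENNReal.toReal_mono hSfin h2
    rwa [ENNReal.toReal_sum (fun w _ => hSfin' w)] at h3
  have hQsum : volume.real Q ≤ ∑ w ∈ F, volume.real (cell Q W w) := by
    have h1 : Q ⊆ ⋃ w ∈ F, cell Q W w := by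
      intro q hq
      obtain ⟨w, hw, hmin⟩ := F.exists_min_image (fun w => dist q w) ⟨w₁, hw₁'⟩
      exact mem_iUnion₂.2 ⟨w, hw, hq, fun w' hw' => hmin w' ((hFW _).2 hw')⟩
    refine (measureReal_mono h1 ?_).trans (measureReal_biUnion_finset_le _ _)
    exact measure_ne_top_of_subset (iUnion₂_subset fun w _ => hCQ w) hQfin
  have hGsum := Finset.sum_le_sum hG
  rw [Finset.sum_sub_distrib, ← Finset.sum_div, Finset.sum_const, nsmul_eq_mul] at hGsum
  rw [hsplit] at hSsum hQsum
  have h0 : 0 ≤ volume.real (S ∩ cell Q W w₁) := measureReal_nonneg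
  have hGn : (G.card : ℝ) + 2 = n := by exact_mod_cast hGcard
  have hfinal : volume.real Q / 2 < volume.real S := by
    rw [← hGn] at hεn
    nlinarith
  rw [gt_iff_lt, ← ENNReal.toReal_lt_toReal (ENNReal.div_ne_top hQfin (by norm_num)) hSfin,
    ENNReal.toReal_div]
  exact hfinal
end

section
/- Let ρ be a real number with 0 < ρ ≤ √3/2 and let W = {(1/4, ρ/2), (3/4, ρ/2)} ⊆ Q. Then every point p ∈ Q satisfies μ({q ∈ Q : dist(q, p) < infDist(q, W)}) ≤ ρ/4. (For aspect ratio at most √3/2, no single black point can steal more than a quarter of the board from the 1×2 grid.) -/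
open MeasureTheory Metric Set
open scoped ENNReal

/-- The rectangular board `[0,1] × [0,ρ]`. -/
def board (ρ : ℝ) : Set (EuclideanSpace ℝ (Fin 2)) :=
  {q | q 0 ∈ Set.Icc (0:ℝ) 1 ∧ q 1 ∈ Set.Icc (0:ℝ) ρ}


lemma ineqA (h b α : ℝ) (hh : 0 < h) (h3 : h^2 ≤ 3/16) (hb : 0 ≤ b) (hbh : b ≤ h)
    (ha : 0 ≤ α) (ha2 : α ≤ 1/2) :
    (4*b*h - 2*b^2 + α*(1-α)/2)^2 ≤ (1-α)*(4*b^2+α^2) := by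
  obtain ⟨r, hr0, hr⟩ : ∃ r : ℝ, 0 ≤ r ∧ r^2 = 3 := ⟨√3, by positivity, by norm_num⟩
  have hhr : 4*h ≤ r := abs_le_of_sq_le_sq' (by nlinarith) hr0 |>.2
  obtain ⟨c, hc⟩ : ∃ c, c = r*b := ⟨_, rfl⟩
  have hc0 : 0 ≤ c := by rw [hc]; positivity
  have hcb : b^2 = c^2/3 := by rw [hc, mul_pow, hr]; ring
  have hc1 : c ≤ 3/4 := by
    have : c^2 ≤ (3/4)^2 := by nlinarith
    exact abs_le_of_sq_le_sq' this (by norm_num) |>.2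
  have h4 : 4*b*h ≤ c := by rw [hc]; nlinarith
  have hX : (4*b*h - 2*b^2 + α*(1-α)/2)^2 ≤ (c - 2*b^2 + α*(1-α)/2)^2 := by
    apply pow_le_pow_left₀
    · nlinarith [mul_nonneg ha (by linarith : 0 ≤ 1-α)]
    · linarith
  refine hX.trans ?_
  rw [hcb]
  obtain ⟨K, hK⟩ : ∃ K, K = 2*c^2/3+α^2/2 := ⟨_, rfl⟩
  have key : 0 ≤ (c-3*α/2)^2/3 + K*(2*c-α-K) := by
    have hK0 : 0 ≤ K := by rw [hK]; positivity
    have hK1 : K ≤ c/2 + α/4 := by rw [hK]; nlinarith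
    -- 2c-α-K ≥ 3c/2 - 5α/4
    by_cases hq : 5*α/6 ≤ c
    · have : 0 ≤ K*(2*c-α-K) := mul_nonneg hK0 (by linarith)
      positivity
    · push Not at hq
      have : K*(5*α/4-3*c/2) ≤ (c/2+α/4)*(5*α/4-3*c/2) :=
        mul_le_mul_of_nonneg_right hK1 (by linarith)
      have h5 : K*(3*c/2-5*α/4) ≤ K*(2*c-α-K) := mul_le_mul_of_nonneg_left (by linarith) hK0
      nlinarith [mul_nonneg hc0 ha]
  have : (1-α)*(4*(c^2/3)+α^2) - (c - 2*(c^2/3) + α*(1-α)/2)^2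
      = (c-3*α/2)^2/3 + K*(2*c-α-K) := by rw [hK]; ring
  linarith

lemma ineqT (h b α : ℝ) (hh : 0 < h) (h3 : h^2 ≤ 3/16) (hb : 0 < b) (hbh : b ≤ h)
    (ha : 0 ≤ α) (ha2 : α ≤ 1/2) (hB : α*(1-α)/4 ≤ 2*b*h+b^2)
    (hT : 2*b*h-b^2+α*(1-α)/4 ≤ α/2) :
    (2*b*h-b^2+α*(1-α)/4)^2 ≤ 2*b*h*(α*(1-α)) := by
  have hbh0 : 0 < b*h := by positivity
  have hT0 : 0 ≤ 2*b*h-b^2+α*(1-α)/4 := by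
    nlinarith [mul_nonneg ha (by linarith : 0 ≤ 1-α)]
  by_cases hz : α ≤ 8*b*h*(1-α)
  · calc _ ≤ (α/2)^2 := pow_le_pow_left₀ hT0 hT 2
      _ ≤ _ := by nlinarith
  push Not at hz
  obtain ⟨z, hzz⟩ : ∃ z, z = 8*b*h := ⟨_, rfl⟩
  have hz0 : 0 < z := by rw [hzz]; positivity
  obtain ⟨e, he⟩ : ∃ e, e = z/(1+z) := ⟨_, rfl⟩
  have he1 : e*(1+z) = z := by rw [he]; field_simp
  have he0 : 0 < e := by rw [he]; positivity
  have hee : e = z*(1-e) := by linarith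
  have hea : e ≤ α := by
    rw [← hzz] at hz; nlinarith
  have h1 : z - 4*b^2 ≤ e*(1+e) := by
    have : e*(1+e) = z*(1+2*z)/(1+z)^2 := by rw [he]; field_simp; ring
    rw [this, le_div_iff₀ (by positivity)]
    have : 4*z^3 ≤ 16*b^2*(1+z)^2 := by
      have : z^2 = 64*b^2*h^2 := by rw [hzz]; ring
      have h6 : z^3 ≤ 12*b^2*z := by
        have : z^2 ≤ 12*b^2 := by rw [this]; nlinarith [sq_nonneg b]
        nlinarith
      have : 12*b^2*z ≤ 4*b^2*(1+z)^2 := by nlinarith [sq_nonneg b, sq_nonneg (z-1), mul_nonneg (sq_nonneg b) (by nlinarith [sq_nonneg (z-1)] : 0 ≤ 4*(1+z)^2-12*z)]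
      linarith
    nlinarith
  obtain ⟨P, hP⟩ : ∃ P, P = α*(1-α)/4 := ⟨_, rfl⟩
  obtain ⟨R, hR⟩ : ∃ R, R = e*(1-e)/4 := ⟨_, rfl⟩
  have hRP : R ≤ P := by rw [hP, hR]; nlinarith [mul_nonneg (sub_nonneg.2 hea) (by linarith : 0 ≤ 1-α-e)]
  have hR0 : 0 < R := by rw [hR]; have : 0 < 1-e := by linarith
                         positivity
  have hu : 0 ≤ z/4 - b^2 := by rw [hzz]; nlinarith
  have fR : (z/4-b^2+R)^2 ≤ z*R := by
    have : z*R = (e/2)^2 := by rw [hR]; linear_combination (-(e/4))*hee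
    rw [this]; apply pow_le_pow_left₀ (by linarith)
    rw [hR]; linarith
  have fQ : (z/4-b^2+(z/4+b^2))^2 ≤ z*(z/4+b^2) := by nlinarith [mul_nonneg hz0.le (sq_nonneg b)]
  have hPQ : P ≤ z/4+b^2 := by rw [hP, hzz]; linarith
  have e1 : 2*b*h-b^2+α*(1-α)/4 = z/4-b^2+P := by rw [hP, hzz]; ring
  have e2 : 2*b*h*(α*(1-α)) = z*P := by rw [hP, hzz]; ring
  rw [e1, e2]
  obtain ⟨Q, hQ⟩ : ∃ Q, Q = z/4+b^2 := ⟨_, rfl⟩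
  rw [← hQ] at fQ hPQ
  obtain ⟨u, hu'⟩ : ∃ u, u = z/4-b^2 := ⟨_, rfl⟩
  rw [← hu'] at fQ fR ⊢
  rcases eq_or_lt_of_le (hRP.trans hPQ) with h | h
  · have : P = R := by linarith
    rw [this]; exact fR
  · have : 0 ≤ (Q-R)*(z*P-(u+P)^2) := by
      nlinarith [mul_nonneg (sub_nonneg.2 hRP) (sub_nonneg.2 fQ), mul_nonneg (sub_nonneg.2 hPQ) (sub_nonneg.2 fR), mul_nonneg (mul_nonneg (sub_nonneg.2 hRP) (sub_nonneg.2 hPQ)) (sub_pos.2 h).le]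
    have := nonneg_of_mul_nonneg_right this (sub_pos.2 h)
    linarith

/-- area of trapezoid -/
lemma trap (c d k m k' m' A : ℝ) (hcd : c ≤ d) (hw : ∀ y, c ≤ y → y ≤ d → 0 ≤ k*y+m)
    (hA : (d-c)*(k*(c+d)/2+m) = A) :
    volume {z : ℝ × ℝ | c ≤ z.2 ∧ z.2 ≤ d ∧ k'*z.2+m' ≤ z.1 ∧ z.1 ≤ k'*z.2+m'+(k*z.2+m)} 
      ≤ ENNReal.ofReal A := by
  have hm : MeasurableSet {z : ℝ × ℝ | c ≤ z.2 ∧ z.2 ≤ d ∧ k'*z.2+m' ≤ z.1 ∧ z.1 ≤ k'*z.2+m'+(k*z.2+m)} := by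
    have c1 : Continuous (fun z : ℝ × ℝ => k'*z.2+m') := by fun_prop
    have c2 : Continuous (fun z : ℝ × ℝ => k'*z.2+m'+(k*z.2+m)) := by fun_prop
    exact ((isClosed_le continuous_const continuous_snd).and ((isClosed_le continuous_snd continuous_const).and
      ((isClosed_le c1 continuous_fst).and (isClosed_le continuous_fst c2)))).measurableSet
  rw [Measure.volume_eq_prod, Measure.prod_apply_symm hm]
  calc _ ≤ ∫⁻ y, (Icc c d).indicator (fun y => ENNReal.ofReal (k*y+m)) y := by
        apply lintegral_mono
        intro y
        by_cases hy : y ∈ Icc c d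
        · rw [indicator_of_mem hy]
          refine (measure_mono (t := Icc (k'*y+m') (k'*y+m'+(k*y+m))) ?_).trans ?_
          · rintro x ⟨-, -, h1, h2⟩; exact ⟨h1, h2⟩
          · rw [Real.volume_Icc]; simp
        · rw [indicator_of_notMem hy]
          refine le_of_eq ?_
          convert measure_empty (μ := (volume : Measure ℝ))
          ext x; simp only [mem_preimage, mem_ofPred_eq, mem_empty_iff_false, iff_false]
          rintro ⟨h1, h2, -⟩; exact hy ⟨h1, h2⟩
    _ = ∫⁻ y in Icc c d, ENNReal.ofReal (k*y+m) := lintegral_indicator measurableSet_Icc _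
    _ = ENNReal.ofReal (∫ y in Icc c d, (k*y+m)) := by
        rw [ofReal_integral_eq_lintegral_ofReal]
        · exact (Continuous.continuousOn (by fun_prop)).integrableOn_Icc
        · filter_upwards [self_mem_ae_restrict measurableSet_Icc] with y hy
          exact hw y hy.1 hy.2
    _ ≤ _ := by
        apply ENNReal.ofReal_le_ofReal
        rw [integral_Icc_eq_integral_Ioc, ← intervalIntegral.integral_of_le hcd]
        rw [intervalIntegral.integral_add (Continuous.intervalIntegrable (by fun_prop) _ _) (Continuous.intervalIntegrable (by fun_prop) _ _)]
        have e1 : ∫ y in c..d, k*y = k*((d^2-c^2)/2) := by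
          rw [← integral_id]; exact intervalIntegral.integral_const_mul k _
        rw [e1, intervalIntegral.integral_const, smul_eq_mul]
        rw [← hA]; apply le_of_eq; ring

lemma trap' (S : Set (ℝ × ℝ)) (c d k' m' k m A : ℝ) (hcd : c ≤ d)
    (hw : ∀ y, c ≤ y → y ≤ d → k'*y+m' ≤ k*y+m)
    (hS : ∀ x y, (x, y) ∈ S → c ≤ y ∧ y ≤ d ∧ k'*y+m' ≤ x ∧ x ≤ k*y+m)
    (hA : (d-c)*((k-k')*(c+d)/2+(m-m')) = A) :
    volume S ≤ ENNReal.ofReal A := by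
  refine (measure_mono ?_).trans (trap c d (k-k') (m-m') k' m' A hcd ?_ hA)
  · rintro ⟨x, y⟩ hz
    obtain ⟨h1, h2, h3, h4⟩ := hS x y hz
    exact ⟨h1, h2, h3, by simp only; linarith⟩
  · intro y h1 h2
    linarith [hw y h1 h2]

lemma two_s19 (S : Set (ℝ × ℝ)) (y₁ A B C : ℝ) (hA : 0 ≤ A) (hB : 0 ≤ B)
    (h1 : volume {z ∈ S | z.2 ≤ y₁} ≤ ENNReal.ofReal A)
    (h2 : volume {z ∈ S | y₁ < z.2} ≤ ENNReal.ofReal B) (hC : A + B ≤ C) :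
    volume S ≤ ENNReal.ofReal C := by
  calc volume S ≤ volume ({z ∈ S | z.2 ≤ y₁} ∪ {z ∈ S | y₁ < z.2}) := by
        apply measure_mono
        intro z hz
        rcases le_or_gt z.2 y₁ with h | h
        · exact Or.inl ⟨hz, h⟩
        · exact Or.inr ⟨hz, h⟩
    _ ≤ _ := measure_union_le _ _
    _ ≤ _ := add_le_add h1 h2
    _ = ENNReal.ofReal (A+B) := (ENNReal.ofReal_add hA hB).symm
    _ ≤ _ := ENNReal.ofReal_le_ofReal hC


lemma key (h b α β T : ℝ) (hh : 0 < h) (h3 : h^2 ≤ 3/16) (hb : 0 ≤ b) (hbh : b ≤ h)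
    (ha : -1/2 ≤ α) (ha2 : α ≤ 1/2) (hβ : β = 1 - α) (hβ0 : 0 < β) (hh1 : h < 1/2) (hT0 : 0 < T)
    (hTv : 2*T = 4*b*h - 2*b^2 + α*(1-α)/2) : (2*T)^2 ≤ β*(4*b^2+α^2) := by
  rw [hTv]
  rcases le_or_gt 0 α with hα | hα
  · rw [hβ]; exact ineqA h b α hh h3 hb hbh hα ha2
  · calc (4*b*h - 2*b^2 + α*(1-α)/2)^2 ≤ (2*b)^2 := by
          apply pow_le_pow_left₀
          · linarith
          · nlinarith [sq_nonneg b]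
      _ ≤ _ := by nlinarith [sq_nonneg b, sq_nonneg α]

lemma coreT (h b α β s T y₀ : ℝ) (S : Set (ℝ × ℝ)) (hh : 0 < h) (h3 : h^2 ≤ 3/16) (hbh : b ≤ h)
    (ha : -1/2 ≤ α) (ha2 : α ≤ 1/2) (hβ : β = 1 - α) (hs : s = b^2 - α*β/4)
    (hS : ∀ x y, (x, y) ∈ S → x ≤ 1/2 ∧ -h ≤ y ∧ y ≤ h ∧ -(β*x) < 2*b*y-s ∧ α*x < 2*b*y-s)
    (hβ0 : 0 < β) (hh1 : h < 1/2) (hB : -(2*b*h)-s < 0) (hb0 : 0 < b) (hTd : T = 2*b*h - s)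
    (hT0 : 0 < T) (hsy : s = 2*b*y₀) (hTy : T = 2*b*(h-y₀)) (hy0h : y₀ < h) :
    volume S ≤ ENNReal.ofReal (h/2) := by
  have hb := hb0.le
  have hl' : ∀ x y, (x, y) ∈ S → -(2*b)/β*y + 2*b*y₀/β ≤ x := by
    intro x y hz
    obtain ⟨-, -, -, h1, -⟩ := hS x y hz
    have : -(2*b)/β*y + 2*b*y₀/β = (-(2*b)*y+s)/β := by rw [hsy]; ring
    rw [this, div_le_iff₀ hβ0]; linarith
  have ht : ∀ x y, (x, y) ∈ S → -(β*x) < 2*b*(y-y₀) ∧ α*x < 2*b*(y-y₀) := by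
    intro x y hz
    obtain ⟨_, h1, h2, h3, h4⟩ := hS x y hz
    rw [hsy] at h3 h4
    constructor <;> linarith
  have el : ∀ y, -(2*b)/β*y + 2*b*y₀/β = -(2*b*(y-y₀)/β) := fun y => by ring
  have er : ∀ y, (2*b)/α*y + -(2*b*y₀)/α = (2*b*(y-y₀)/α) := fun y => by ring
  have hTv : 2*T = 4*b*h - 2*b^2 + α*(1-α)/2 := by rw [hTd, hs, hβ]; ring
  have hTβ : T ≤ β/2 := by
    rw [hβ]
    nlinarith [sq_nonneg (h-b), sq_nonneg (α-1/2)]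
  have hkey := key h b α β T hh h3 hb hbh ha ha2 hβ hβ0 hh1 hT0 hTv
  have hfin : T^2/(4*b*β) + (h/2 - (4*b^2+α^2)/(16*b)) ≤ h/2 := by
    have : T^2/(4*b*β) ≤ (4*b^2+α^2)/(16*b) := by
      rw [div_le_div_iff₀ (by positivity) (by positivity)]
      nlinarith
    linarith
  have hfe : h/2 - (4*b^2+α^2)/(16*b) = T/(4*b) - α/(16*b) := by
    have e : T = 2*b*h-b^2+α*(1-α)/4 := by linarith
    rw [e]; field_simp; ring
  obtain ⟨y₁, hy₁⟩ : ∃ y₁, y₁ = y₀ + α/(4*b) := ⟨_, rfl⟩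
  have hy₁' : 2*b*(y₁-y₀) = α/2 := by rw [hy₁]; field_simp; ring
  rcases le_or_gt 0 α with hα | hα
  · have hyt : ∀ x y, (x, y) ∈ S → y₀ < y := by
      intro x y hz
      obtain ⟨h1, h2⟩ := ht x y hz
      by_contra hy
      push Not at hy
      have h5 : 2*b*(y-y₀) ≤ 0 := mul_nonpos_of_nonneg_of_nonpos (by positivity) (by linarith)
      rcases le_or_gt 0 x with hx | hx
      · have := mul_nonneg hα hx
        linarith
      · have := mul_nonneg hβ0.le (neg_nonneg.2 hx.le)
        linarith
    rcases le_or_gt T (α/2) with hTα | hTα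
    · have hα0 : 0 < α := by linarith
      have := ineqT h b α hh h3 hb0 hbh hα ha2 (by rw [hs, hβ] at hB; linarith) (by linarith)
      refine (trap' S y₀ h (-(2*b)/β) (2*b*y₀/β) (2*b/α) (-(2*b*y₀)/α) (T^2/(4*b*(α*β))) hy0h.le ?_ ?_ ?_).trans ?_
      · intro y h1 h2
        have : 0 ≤ y-y₀ := by linarith
        rw [el, er]
        have : 0 ≤ (2*b*(y-y₀))/β := by positivity
        have : 0 ≤ (2*b*(y-y₀))/α := by positivity
        linarith
      · intro x y hz
        refine ⟨(hyt x y hz).le, (hS x y hz).2.2.1, hl' x y hz, ?_⟩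
        rw [er, le_div_iff₀ hα0]; linarith [(ht x y hz).2]
      · rw [hTy]
        have : α + β = 1 := by linarith
        field_simp
        linear_combination (4 * (h-y₀)^2) * this
      · apply ENNReal.ofReal_le_ofReal
        rw [div_le_iff₀ (by positivity)]
        rw [hβ]
        have e : T = 2*b*h-b^2+α*(1-α)/4 := by linarith
        rw [e]
        linarith
    · have hy1h : y₁ ≤ h := by
        have : 2*b*(y₁-y₀) ≤ 2*b*(h-y₀) := by linarith
        have := le_of_mul_le_mul_left this (by positivity)
        linarith
      have hy01 : y₀ ≤ y₁ := by
        have : 0 ≤ α/(4*b) := by positivity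
        linarith
      have hyh : h - y₁ = (T-α/2)/(2*b) := by
        rw [eq_div_iff (by positivity), hTy]; linarith
      have hyd : y₁ - y₀ = α/(4*b) := by linarith
      refine two_s19 S y₁ ((y₁-y₀)*(1/2+α/(2*β))/2) ((h-y₁)*((1/2+α/(2*β))+(1/2+T/β))/2) _ ?_ ?_ ?_ ?_ ?_
      · have : 0 ≤ y₁-y₀ := by linarith
        positivity
      · have : 0 ≤ h-y₁ := by linarith
        positivity
      · rcases eq_or_lt_of_le hα with h0 | hα0
        · have : {z ∈ S | z.2 ≤ y₁} = ∅ := by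
            rw [eq_empty_iff_forall_notMem]
            rintro ⟨x, y⟩ ⟨hz, hy⟩
            have := hyt x y hz
            rw [← h0] at hyd
            simp at hyd hy
            linarith
          rw [this]; simp
        · refine trap' _ y₀ y₁ (-(2*b)/β) (2*b*y₀/β) (2*b/α) (-(2*b*y₀)/α) _ hy01 ?_ ?_ ?_
          · intro y h1 h2
            have : 0 ≤ y-y₀ := by linarith
            rw [el, er]
            have : 0 ≤ (2*b*(y-y₀))/β := by positivity
            have : 0 ≤ (2*b*(y-y₀))/α := by positivity
            linarith
          · rintro x y ⟨hz, hy⟩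
            refine ⟨(hyt x y hz).le, hy, hl' x y hz, ?_⟩
            rw [er, le_div_iff₀ hα0]; linarith [(ht x y hz).2]
          · have e : y₁ = y₀ + α/(4*b) := hy₁
            rw [e]; field_simp; ring
      · refine trap' _ y₁ h (-(2*b)/β) (2*b*y₀/β) 0 (1/2) _ hy1h ?_ ?_ ?_
        · intro y h1 h2
          have : 0 ≤ y-y₀ := by linarith
          rw [el]
          have : 0 ≤ (2*b*(y-y₀))/β := by positivity
          linarith
        · rintro x y ⟨hz, hy⟩
          refine ⟨hy.le, (hS x y hz).2.2.1, hl' x y hz, ?_⟩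
          linarith [(hS x y hz).1]
        · have e : α = 2*(2*b*(y₁-y₀)) := by linarith
          have e2 : α/(2*β) = 2*b*(y₁-y₀)/β := by
            rw [e]; field_simp
          rw [hTy, e2]; ring
      · refine le_trans (le_of_eq ?_) hfin
        rw [hyh, hyd, hfe]; field_simp; ring
  · have hyd : y₀ - y₁ = -α/(4*b) := by rw [hy₁]; ring
    have hyp : 0 < -α/(4*b) := div_pos (by linarith) (by positivity)
    refine two_s19 S y₀ ((y₀-y₁)/4) ((h-y₀)*(1/2+(1/2+T/β))/2) _ (by linarith) ?_ ?_ ?_ ?_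
    · have : 0 ≤ h-y₀ := by linarith
      positivity
    · refine trap' _ y₁ y₀ (2*b/α) (-(2*b*y₀)/α) 0 (1/2) _ (by linarith) ?_ ?_ ?_
      · intro y h1 h2
        rw [er, div_le_iff_of_neg hα]
        have : 2*b*(y₁-y₀) ≤ 2*b*(y-y₀) := mul_le_mul_of_nonneg_left (by linarith) (by positivity)
        linarith
      · rintro x y ⟨hz, hy⟩
        have h1 := (ht x y hz).2
        have h2 := (hS x y hz).1
        refine ⟨?_, hy, ?_, by linarith⟩
        · have : α*(1/2) ≤ α*x := mul_le_mul_of_nonpos_left h2 hα.le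
          have : 2*b*(y₁-y₀) ≤ 2*b*(y-y₀) := by linarith
          have := le_of_mul_le_mul_left this (by positivity)
          linarith
        · rw [er, div_le_iff_of_neg hα]; linarith
      · have hα' : α ≠ 0 := hα.ne
        rw [hy₁]; field_simp; ring
    · refine trap' _ y₀ h (-(2*b)/β) (2*b*y₀/β) 0 (1/2) _ hy0h.le ?_ ?_ ?_
      · intro y h1 h2
        have : 0 ≤ y-y₀ := by linarith
        rw [el]
        have : 0 ≤ (2*b*(y-y₀))/β := by positivity
        linarith
      · rintro x y ⟨hz, hy⟩
        refine ⟨hy.le, (hS x y hz).2.2.1, hl' x y hz, ?_⟩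
        linarith [(hS x y hz).1]
      · rw [hTy]; ring
    · refine le_trans (le_of_eq ?_) hfin
      have : h - y₀ = T/(2*b) := by rw [hTy]; field_simp
      rw [hyd, this, hfe]; field_simp; ring

lemma core_s19 (h b α β s : ℝ) (S : Set (ℝ × ℝ)) (hh : 0 < h) (h3 : h^2 ≤ 3/16) (hb : 0 ≤ b) (hbh : b ≤ h)
    (ha : -1/2 ≤ α) (ha2 : α ≤ 1/2) (hβ : β = 1 - α) (hs : s = b^2 - α*β/4)
    (hS : ∀ x y, (x, y) ∈ S → x ≤ 1/2 ∧ -h ≤ y ∧ y ≤ h ∧ -(β*x) < 2*b*y-s ∧ α*x < 2*b*y-s) :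
    volume S ≤ ENNReal.ofReal (h/2) := by
  have hβ0 : 0 < β := by linarith
  have hbh0 : 0 ≤ b*h := by positivity
  have hh1 : h < 1/2 := by nlinarith
  have hl : ∀ x y, (x, y) ∈ S → -(2*b)/β*y + s/β ≤ x := by
    intro x y hz
    obtain ⟨-, -, -, h1, -⟩ := hS x y hz
    have : -(2*b)/β*y + s/β = (-(2*b)*y+s)/β := by ring
    rw [this, div_le_iff₀ hβ0]; linarith
  by_cases hT : 2*b*h - s ≤ 0
  · have ht : ∀ x y, (x, y) ∈ S → 2*b*y-s ≤ 0 ∧ 0 < x := by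
      intro x y hz
      obtain ⟨-, -, h0, h1, -⟩ := hS x y hz
      have : 2*b*y-s ≤ 0 := by nlinarith
      exact ⟨this, by by_contra hx; nlinarith⟩
    rcases le_or_gt 0 α with hα | hα
    · have : S = ∅ := by
        rw [eq_empty_iff_forall_notMem]
        rintro ⟨x, y⟩ hz
        obtain ⟨-, -, h0, h1, h2⟩ := hS x y hz
        obtain ⟨h4, h5⟩ := ht x y hz
        nlinarith
      rw [this]; simp
    · obtain ⟨n, hn⟩ : ∃ n, n = -α := ⟨_, rfl⟩
      have hn0 : 0 < n := by linarith
      have hc : ∀ x y, (x, y) ∈ S → -(2*b)/n*y + 1/4 ≤ x := by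
        intro x y hz
        obtain ⟨-, -, -, -, h1⟩ := hS x y hz
        have : -(2*b)/n*y + 1/4 = (-(2*b)*y+n/4)/n := by field_simp
        rw [this, div_le_iff₀ hn0]
        subst hs hβ
        have : α = -n := by linarith
        subst this
        nlinarith [sq_nonneg b, sq_nonneg n]
      rcases le_or_gt n (8*b*h) with hnb | hnb
      · have hb0 : 0 < b := by by_contra hb'; have : b = 0 := by linarith
                               subst this; linarith
        have e1 : n/(8*b) ≤ h := by rw [div_le_iff₀ (by positivity)]; linarith
        refine two_s19 S (n/(8*b)) (n/(16*b)) (h/2-n/(16*b)) _ (by positivity) ?_ ?_ ?_ (by linarith)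
        · have : n/(16*b) = n/(8*b)/2 := by field_simp; norm_num
          linarith
        · refine trap' _ (-(n/(8*b))) (n/(8*b)) (-(2*b)/n) (1/4) 0 (1/2) _ ?_ ?_ ?_ ?_
          · have : 0 < n/(8*b) := by positivity
            linarith
          · intro y h1 h2
            have : (2*b)/n*y ≥ (2*b)/n*(-(n/(8*b))) := mul_le_mul_of_nonneg_left h1 (by positivity)
            have e : (2*b)/n*(-(n/(8*b))) = -1/4 := by field_simp; norm_num
            have : -(2*b)/n*y = -((2*b)/n*y) := by ring
            linarith
          · rintro x y ⟨hz, h2⟩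
            have h1 := hc x y hz
            have h3 := (hS x y hz).1
            refine ⟨?_, h2, h1, by linarith⟩
            have : (2*b)/n*(-(n/(8*b))) ≤ (2*b)/n*y := by
              have e : (2*b)/n*(-(n/(8*b))) = -1/4 := by field_simp; norm_num
              have : -(2*b)/n*y = -((2*b)/n*y) := by ring
              linarith
            exact le_of_mul_le_mul_left this (by positivity)
          · field_simp; ring
        · refine trap' _ (n/(8*b)) h 0 0 0 (1/2) _ e1 ?_ ?_ ?_
          · intro y h1 h2; norm_num
          · rintro x y ⟨hz, h2⟩
            have := hS x y hz
            have := ht x y hz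
            refine ⟨h2.le, ?_, ?_, ?_⟩ <;> linarith
          · field_simp; ring
      · refine trap' _ (-h) h (-(2*b)/n) (1/4) 0 (1/2) _ (by linarith) ?_ ?_ ?_
        · intro y h1 h2
          have : -(2*b)/n*y + 1/4 = (-(2*b)*y+n/4)/n := by field_simp
          rw [this, div_le_iff₀ hn0]
          nlinarith
        · intro x y hz
          have := hS x y hz
          have := hc x y hz
          refine ⟨?_, ?_, ?_, ?_⟩ <;> linarith
        · ring
  push Not at hT
  rcases le_or_gt 0 (-(2*b*h)-s) with hB | hB
  · have hα : 0 < α := by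
      by_contra hα
      push Not at hα
      nlinarith [mul_nonneg (neg_nonneg.2 hα) hβ0.le, sq_nonneg b]
    refine (trap' S (-h) h (-(2*b)/β) (s/β) (2*b/α) (-s/α) _ (by linarith) ?_ ?_ rfl).trans ?_
    · intro y h1 h2
      have : 0 ≤ 2*b*y-s := by nlinarith
      have e1 : -(2*b)/β*y + s/β = -((2*b*y-s)/β) := by ring
      have e2 : (2*b)/α*y + -s/α = ((2*b*y-s)/α) := by ring
      rw [e1, e2]
      have : 0 ≤ (2*b*y-s)/β := by positivity
      have : 0 ≤ (2*b*y-s)/α := by positivity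
      linarith
    · intro x y hz
      obtain ⟨_, h1, h2, _, h4⟩ := hS x y hz
      refine ⟨h1, h2, hl x y hz, ?_⟩
      have e2 : (2*b)/α*y + -s/α = ((2*b*y-s)/α) := by ring
      rw [e2, le_div_iff₀ hα]; linarith
    · apply ENNReal.ofReal_le_ofReal
      have e : -s/α - s/β = -s/(α*β) := by
        field_simp; rw [hβ]; ring
      have : -s/(α*β) ≤ 1/4 := by
        rw [div_le_iff₀ (by positivity), hs]; nlinarith [sq_nonneg b]
      rw [e]
      nlinarith
  have hb0 : 0 < b := by
    by_contra hb'; have : b = 0 := by linarith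
    subst this; linarith
  obtain ⟨T, hTd⟩ : ∃ T, T = 2*b*h - s := ⟨_, rfl⟩
  have hT0 : 0 < T := by linarith
  obtain ⟨y₀, hy₀⟩ : ∃ y₀, y₀ = s/(2*b) := ⟨_, rfl⟩
  have hsy : s = 2*b*y₀ := by rw [hy₀]; field_simp
  have hTy : T = 2*b*(h-y₀) := by rw [hTd, hsy]; ring
  have hy0h : y₀ < h := by
    have : 0 < 2*b*(h-y₀) := by linarith
    have := pos_of_mul_pos_right this (by positivity)
    linarith
  exact coreT h b α β s T y₀ S hh h3 hbh ha ha2 hβ hs hS hβ0 hh1 hB hb0 hTd hT0 hsy hTy hy0h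

def Reg (h a b : ℝ) : Set (ℝ × ℝ) :=
  {z | -1/2 ≤ z.1 ∧ z.1 ≤ 1/2 ∧ -h ≤ z.2 ∧ z.2 ≤ h ∧
    (z.1-a)^2+(z.2-b)^2 < (z.1+1/4)^2+z.2^2 ∧ (z.1-a)^2+(z.2-b)^2 < (z.1-1/4)^2+z.2^2}

lemma reg_pos (h a b : ℝ) (hh : 0 < h) (h3 : h^2 ≤ 3/16) (hb : 0 ≤ b) (hbh : b ≤ h)
    (ha : 0 ≤ a) (ha2 : a ≤ 1/2) : volume (Reg h a b) ≤ ENNReal.ofReal (h/2) := by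
  refine core_s19 h b (1/2-2*a) (1/2+2*a) (a^2+b^2-1/16) _ hh h3 hb hbh (by linarith) (by linarith) (by ring) (by ring) ?_
  rintro x y ⟨h1, h2, h4, h5, h6, h7⟩
  simp only at *
  refine ⟨h2, h4, h5, ?_, ?_⟩ <;> linarith

lemma reg_meas (h a b : ℝ) : MeasurableSet (Reg h a b) := by
  unfold Reg
  measurability

lemma reg_negx (h a b : ℝ) : volume (Reg h (-a) b) = volume (Reg h a b) := by
  have hm : MeasurePreserving (Prod.map (fun x : ℝ => -x) (id : ℝ → ℝ)) (volume : Measure (ℝ × ℝ)) volume :=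
    (Measure.measurePreserving_neg (volume : Measure ℝ)).prod (MeasurePreserving.id _)
  rw [← hm.measure_preimage (reg_meas h (-a) b).nullMeasurableSet]
  congr 1
  ext ⟨x, y⟩
  simp only [Reg, mem_preimage, Prod.map, mem_ofPred_eq, id]
  constructor <;> rintro ⟨h1, h2, h4, h5, h6, h7⟩ <;> refine ⟨?_, ?_, ?_, ?_, ?_, ?_⟩ <;> linarith

lemma reg_negy (h a b : ℝ) : volume (Reg h a (-b)) = volume (Reg h a b) := by
  have hm : MeasurePreserving (Prod.map (id : ℝ → ℝ) (fun x : ℝ => -x)) (volume : Measure (ℝ × ℝ)) volume :=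
    (MeasurePreserving.id _).prod (Measure.measurePreserving_neg (volume : Measure ℝ))
  rw [← hm.measure_preimage (reg_meas h a (-b)).nullMeasurableSet]
  congr 1
  ext ⟨x, y⟩
  simp only [Reg, mem_preimage, Prod.map, mem_ofPred_eq, id]
  constructor <;> rintro ⟨h1, h2, h4, h5, h6, h7⟩ <;> refine ⟨?_, ?_, ?_, ?_, ?_, ?_⟩ <;> linarith

lemma reg_all (h a b : ℝ) (hh : 0 < h) (h3 : h^2 ≤ 3/16) (hb : -h ≤ b) (hbh : b ≤ h)
    (ha : -1/2 ≤ a) (ha2 : a ≤ 1/2) : volume (Reg h a b) ≤ ENNReal.ofReal (h/2) := by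
  have step : ∀ a, 0 ≤ a → a ≤ 1/2 → volume (Reg h a b) ≤ ENNReal.ofReal (h/2) := by
    intro a h1 h2
    rcases le_total 0 b with h0 | h0
    · exact reg_pos h a b hh h3 h0 hbh h1 h2
    · rw [← reg_negy]
      exact reg_pos h a (-b) hh h3 (by linarith) (by linarith) h1 h2
  rcases le_total 0 a with h0 | h0
  · exact step a h0 ha2
  · rw [← reg_negx]
    exact step (-a) (by linarith) (by linarith)

/-- For aspect ratio `ρ ≤ √3/2`, against the `1 × 2` grid
`W = {(1/4, ρ/2), (3/4, ρ/2)}`, no single black point can steal more than a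
quarter of the board. -/
theorem stmt_19 (ρ : ℝ) (hρ0 : 0 < ρ) (hρ1 : ρ ≤ Real.sqrt 3 / 2)
    (W : Set (EuclideanSpace ℝ (Fin 2)))
    (hW : W = {pt (1/4) (ρ/2), pt (3/4) (ρ/2)})
    (p : EuclideanSpace ℝ (Fin 2)) (hp : p ∈ board ρ) :
    volume {q | q ∈ board ρ ∧ dist q p < infDist q W} ≤ ENNReal.ofReal (ρ / 4) := by
  have h3 : (ρ/2)^2 ≤ 3/16 := by
    have : ρ^2 ≤ (Real.sqrt 3 / 2)^2 := pow_le_pow_left₀ hρ0.le hρ1 2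
    rw [div_pow, Real.sq_sqrt (by norm_num)] at this
    nlinarith
  obtain ⟨⟨p1, p2⟩, p3, p4⟩ := hp
  have hmain := reg_all (ρ/2) (p 0 - 1/2) (p 1 - ρ/2) (by linarith) h3 (by linarith) (by linarith)
    (by linarith) (by linarith)
  have m1 := PiLp.volume_preserving_ofLp (Fin 2)
  have m2 := volume_preserving_finTwoArrow ℝ
  have m3 : MeasurePreserving (Prod.map (fun x : ℝ => x - 1/2) (fun y : ℝ => y - ρ/2))
      (volume : Measure (ℝ × ℝ)) volume :=
    (measurePreserving_sub_right (volume : Measure ℝ) (1/2)).prod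
      (measurePreserving_sub_right (volume : Measure ℝ) (ρ/2))
  have m := m3.comp (m2.comp m1)
  have e : ρ/4 = ρ/2/2 := by ring
  rw [e]
  refine le_trans ?_ hmain
  rw [← m.measure_preimage (reg_meas _ _ _).nullMeasurableSet]
  apply measure_mono
  rintro q ⟨⟨⟨q1, q2⟩, q3, q4⟩, hd⟩
  have d1 : dist q p < dist q (pt (1/4) (ρ/2)) :=
    hd.trans_le (infDist_le_dist_of_mem (by rw [hW]; simp))
  have d2 : dist q p < dist q (pt (3/4) (ρ/2)) :=
    hd.trans_le (infDist_le_dist_of_mem (by rw [hW]; simp))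
  rw [EuclideanSpace.dist_eq, EuclideanSpace.dist_eq, Real.sqrt_lt_sqrt_iff (by positivity)] at d1 d2
  simp [Fin.sum_univ_two, Real.dist_eq, sq_abs, pt] at d1 d2
  refine ⟨?_, ?_, ?_, ?_, ?_, ?_⟩ <;>
    simp [MeasurableEquiv.finTwoArrow] <;> linarith
end
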